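/- Let Y_1, Y_2, Y_3, Y_4 be independent finitely supported random variables taking values in an abelian group G. Then d[Y_1 − Y_3; Y_2 − Y_4] + d[Y_1 | Y_1 − Y_3; Y_2 | Y_2 − Y_4] + I[Y_1 − Y_2 : Y_2 − Y_4 | Y_1 − Y_2 − Y_3 + Y_4] = d[Y_1; Y_2] + d[Y_3; Y_4]. -/

import Mathlib

open scoped Classical BigOperators Pointwise
open Finset

noncomputable section

/-- The probability that the random variable `X` equals `s`, under the pmf `μ`. -/
def pmass {Ω S : Type*} [Fintype Ω] (μ : Ω → ℝ) (X : Ω → S) (s : S) : ℝ :=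
  ∑ ω, if X ω = s then μ ω else 0

/-- `μ` is a probability mass function on the finite type `Ω`. -/
def IsProb {Ω : Type*} [Fintype Ω] (μ : Ω → ℝ) : Prop :=
  (∀ ω, 0 ≤ μ ω) ∧ ∑ ω, μ ω = 1

/-- Shannon entropy `H[X]` of a random variable `X : Ω → S` under `μ`. -/
def ent {Ω S : Type*} [Fintype Ω] (μ : Ω → ℝ) (X : Ω → S) : ℝ :=
  ∑ s ∈ Finset.univ.image X, Real.negMulLog (pmass μ X s)

/-- Mutual information `I[X : Y]`. -/
def mutualInfo {Ω S T : Type*} [Fintype Ω] (μ : Ω → ℝ) (X : Ω → S) (Y : Ω → T) : ℝ :=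
  ent μ X + ent μ Y - ent μ (fun ω => (X ω, Y ω))

/-- The conditional measure, conditioning on the event `Y = y`. -/
def condMeas {Ω T : Type*} [Fintype Ω] (μ : Ω → ℝ) (Y : Ω → T) (y : T) : Ω → ℝ :=
  fun ω => if Y ω = y then μ ω / pmass μ Y y else 0

/-- Conditional mutual information `I[X : Y | Z]`. -/
def condMutualInfo {Ω S T U : Type*} [Fintype Ω] (μ : Ω → ℝ)
    (X : Ω → S) (Y : Ω → T) (Z : Ω → U) : ℝ :=
  ∑ z ∈ Finset.univ.image Z, pmass μ Z z * mutualInfo (condMeas μ Z z) X Y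

/-- Entropic Ruzsa distance `d[X ; Y]`, defined via independent copies on a product space. -/
def rdist {Ω₁ Ω₂ G : Type*} [Fintype Ω₁] [Fintype Ω₂] [AddCommGroup G]
    (μ₁ : Ω₁ → ℝ) (X : Ω₁ → G) (μ₂ : Ω₂ → ℝ) (Y : Ω₂ → G) : ℝ :=
  ent (fun p : Ω₁ × Ω₂ => μ₁ p.1 * μ₂ p.2) (fun p => X p.1 - Y p.2)
    - ent μ₁ X / 2 - ent μ₂ Y / 2

/-- Conditional Ruzsa distance `d[X | Z ; Y | W]`. -/
def condRdist {Ω₁ Ω₂ G T U : Type*} [Fintype Ω₁] [Fintype Ω₂] [AddCommGroup G]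
    (μ₁ : Ω₁ → ℝ) (X : Ω₁ → G) (Z : Ω₁ → T)
    (μ₂ : Ω₂ → ℝ) (Y : Ω₂ → G) (W : Ω₂ → U) : ℝ :=
  ∑ z ∈ Finset.univ.image Z, ∑ w ∈ Finset.univ.image W,
    pmass μ₁ Z z * pmass μ₂ W w * rdist (condMeas μ₁ Z z) X (condMeas μ₂ W w) Y

/-- Conditional Ruzsa distance `d[X ; Y | W]`, conditioning only on the right variable. -/
def condRdistRight {Ω₁ Ω₂ G U : Type*} [Fintype Ω₁] [Fintype Ω₂] [AddCommGroup G]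
    (μ₁ : Ω₁ → ℝ) (X : Ω₁ → G)
    (μ₂ : Ω₂ → ℝ) (Y : Ω₂ → G) (W : Ω₂ → U) : ℝ :=
  ∑ w ∈ Finset.univ.image W, pmass μ₂ W w * rdist μ₁ X (condMeas μ₂ W w) Y

/-- The uniform probability mass function on a subset `H` of a finite type. -/
def unifOn {G : Type*} [Fintype G] (H : Set G) : G → ℝ :=
  fun g => if g ∈ H then ((Nat.card H : ℝ))⁻¹ else 0

/-- `X` (under `μ₁`) and `Y` (under `μ₂`) are identically distributed. -/
def IdentDist {Ω₁ Ω₂ S : Type*} [Fintype Ω₁] [Fintype Ω₂]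
    (μ₁ : Ω₁ → ℝ) (X : Ω₁ → S) (μ₂ : Ω₂ → ℝ) (Y : Ω₂ → S) : Prop :=
  ∀ s, pmass μ₁ X s = pmass μ₂ Y s

/-- Two random variables are independent. -/
def IndepPair {Ω S T : Type*} [Fintype Ω] (μ : Ω → ℝ) (X : Ω → S) (Y : Ω → T) : Prop :=
  ∀ s t, pmass μ (fun ω => (X ω, Y ω)) (s, t) = pmass μ X s * pmass μ Y t

/-- Three random variables are jointly independent. -/
def IndepTriple {Ω S T U : Type*} [Fintype Ω] (μ : Ω → ℝ)
    (X : Ω → S) (Y : Ω → T) (Z : Ω → U) : Prop :=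
  ∀ s t u, pmass μ (fun ω => (X ω, Y ω, Z ω)) (s, t, u)
    = pmass μ X s * pmass μ Y t * pmass μ Z u

/-- Four random variables are jointly independent. -/
def IndepFour {Ω S T U V : Type*} [Fintype Ω] (μ : Ω → ℝ)
    (X : Ω → S) (Y : Ω → T) (Z : Ω → U) (W : Ω → V) : Prop :=
  ∀ s t u v, pmass μ (fun ω => (X ω, Y ω, Z ω, W ω)) (s, t, u, v)
    = pmass μ X s * pmass μ Y t * pmass μ Z u * pmass μ W v


lemma pmass_nonmem {Ω S : Type*} [Fintype Ω] (μ : Ω → ℝ) (X : Ω → S) (s : S)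
    (h : ∀ ω, X ω ≠ s) : pmass μ X s = 0 := by
  unfold pmass
  exact Finset.sum_eq_zero fun ω _ => if_neg (h ω)

lemma ent_eq_sum {Ω S : Type*} [Fintype Ω] (μ : Ω → ℝ) (X : Ω → S) (T : Finset S)
    (h : ∀ ω, X ω ∈ T) : ent μ X = ∑ s ∈ T, Real.negMulLog (pmass μ X s) := by
  unfold ent
  apply Finset.sum_subset
  · intro s hs
    obtain ⟨ω, -, rfl⟩ := Finset.mem_image.1 hs
    exact h ω
  · intro s _ hs
    rw [pmass_nonmem, Real.negMulLog_zero]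
    intro ω hω
    exact hs (Finset.mem_image.2 ⟨ω, Finset.mem_univ _, hω⟩)

lemma ent_ident {Ω Ω' S : Type*} [Fintype Ω] [Fintype Ω'] (μ : Ω → ℝ) (X : Ω → S)
    (μ' : Ω' → ℝ) (X' : Ω' → S) (h : IdentDist μ X μ' X') : ent μ X = ent μ' X' := by
  rw [ent_eq_sum μ X (Finset.univ.image X ∪ Finset.univ.image X'),
    ent_eq_sum μ' X' (Finset.univ.image X ∪ Finset.univ.image X')]
  · exact Finset.sum_congr rfl fun s _ => by rw [h s]
  · intro ω; simp
  · intro ω; simp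

lemma pmass_comp {Ω S T : Type*} [Fintype Ω] (μ : Ω → ℝ) (X : Ω → S) (f : S → T) (t : T)
    (A : Finset S) (hA : ∀ ω, X ω ∈ A) :
    pmass μ (fun ω => f (X ω)) t = ∑ s ∈ A, if f s = t then pmass μ X s else 0 := by
  unfold pmass
  have : ∀ s ∈ A, (if f s = t then ∑ ω, (if X ω = s then μ ω else 0) else 0)
      = ∑ ω, if X ω = s then (if f (X ω) = t then μ ω else 0) else 0 := by
    intro s _
    split_ifs with h
    · refine Finset.sum_congr rfl fun ω _ => ?_
      by_cases h1 : X ω = s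
      · rw [if_pos h1, if_pos h1, h1, if_pos h]
      · rw [if_neg h1, if_neg h1]
    · symm
      refine Finset.sum_eq_zero fun ω _ => ?_
      by_cases h1 : X ω = s
      · rw [if_pos h1, h1, if_neg h]
      · rw [if_neg h1]
  rw [Finset.sum_congr rfl this, Finset.sum_comm]
  refine Finset.sum_congr rfl fun ω _ => ?_
  rw [Finset.sum_ite_eq, if_pos (hA ω)]

lemma ident_comp {Ω Ω' S T : Type*} [Fintype Ω] [Fintype Ω'] (μ : Ω → ℝ) (X : Ω → S)
    (μ' : Ω' → ℝ) (X' : Ω' → S) (h : IdentDist μ X μ' X') (f : S → T) :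
    IdentDist μ (fun ω => f (X ω)) μ' (fun ω => f (X' ω)) := by
  intro t
  rw [pmass_comp μ X f t (Finset.univ.image X ∪ Finset.univ.image X') (by intro ω; simp),
    pmass_comp μ' X' f t (Finset.univ.image X ∪ Finset.univ.image X') (by intro ω; simp)]
  exact Finset.sum_congr rfl fun s _ => by rw [h s]

lemma pmass_inj {Ω S T : Type*} [Fintype Ω] (μ : Ω → ℝ) (X : Ω → S) (f : S → T)
    (hf : Function.Injective f) (s : S) :
    pmass μ (fun ω => f (X ω)) (f s) = pmass μ X s := by
  unfold pmass
  refine Finset.sum_congr rfl fun ω _ => ?_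
  by_cases h : X ω = s
  · rw [if_pos h, if_pos (congrArg f h)]
  · rw [if_neg h, if_neg (fun h' => h (hf h'))]

lemma ent_inj {Ω S T : Type*} [Fintype Ω] (μ : Ω → ℝ) (X : Ω → S) (f : S → T)
    (hf : Function.Injective f) : ent μ (fun ω => f (X ω)) = ent μ X := by
  rw [ent_eq_sum μ (fun ω => f (X ω)) ((Finset.univ.image X).image f) (by intro ω; simp),
    Finset.sum_image (fun a _ b _ h => hf h)]
  unfold ent
  exact Finset.sum_congr rfl fun s _ => by rw [pmass_inj μ X f hf]

lemma sum_pmass {Ω S : Type*} [Fintype Ω] (μ : Ω → ℝ) (X : Ω → S) (A : Finset S)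
    (hA : ∀ ω, X ω ∈ A) : ∑ s ∈ A, pmass μ X s = ∑ ω, μ ω := by
  have := pmass_comp μ X (fun _ => ()) () A hA
  simp [pmass] at this
  simp [pmass, this]

lemma pmass_marg {Ω S T : Type*} [Fintype Ω] (μ : Ω → ℝ) (X : Ω → S) (Y : Ω → T) (t : T)
    (A : Finset S) (hA : ∀ ω, X ω ∈ A) :
    ∑ s ∈ A, pmass μ (fun ω => (X ω, Y ω)) (s, t) = pmass μ Y t := by
  unfold pmass
  rw [Finset.sum_comm]
  refine Finset.sum_congr rfl fun ω _ => ?_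
  by_cases h : Y ω = t
  · simp [h, hA ω]
  · simp [h]

lemma pmass_nonneg {Ω S : Type*} [Fintype Ω] (μ : Ω → ℝ) (hμ : ∀ ω, 0 ≤ μ ω) (X : Ω → S)
    (s : S) : 0 ≤ pmass μ X s := by
  unfold pmass
  refine Finset.sum_nonneg fun ω _ => ?_
  split_ifs
  exacts [hμ ω, le_rfl]

lemma pmass_cond {Ω S T : Type*} [Fintype Ω] (μ : Ω → ℝ) (X : Ω → S) (Z : Ω → T) (s : S)
    (z : T) : pmass (condMeas μ Z z) X s
      = pmass μ (fun ω => (X ω, Z ω)) (s, z) / pmass μ Z z := by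
  have : ∀ c : ℝ, (∑ ω, if X ω = s then (if Z ω = z then μ ω / c else 0) else 0)
      = pmass μ (fun ω => (X ω, Z ω)) (s, z) / c := by
    intro c
    unfold pmass
    rw [Finset.sum_div]
    refine Finset.sum_congr rfl fun ω _ => ?_
    by_cases h : X ω = s <;> by_cases h' : Z ω = z <;> simp [h, h']
  exact this _

lemma chain_rule {Ω S T : Type*} [Fintype Ω] (μ : Ω → ℝ) (hμ : ∀ ω, 0 ≤ μ ω)
    (X : Ω → S) (Z : Ω → T) (B : Finset T) (hB : ∀ ω, Z ω ∈ B) :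
    ∑ z ∈ B, pmass μ Z z * ent (condMeas μ Z z) X
      = ent μ (fun ω => (X ω, Z ω)) - ent μ Z := by
  rw [ent_eq_sum μ (fun ω => (X ω, Z ω)) (Finset.univ.image X ×ˢ B)
      (by intro ω; simp [hB ω]), ent_eq_sum μ Z B hB, Finset.sum_product_right,
      ← Finset.sum_sub_distrib]
  refine Finset.sum_congr rfl fun z _ => ?_
  have hm := pmass_marg μ X Z z (Finset.univ.image X) (by intro ω; simp)
  unfold ent
  simp only [pmass_cond]
  have hnn : ∀ s, 0 ≤ pmass μ (fun ω => (X ω, Z ω)) (s, z) := fun s => pmass_nonneg μ hμ _ _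
  generalize pmass μ Z z = c at *
  generalize hp : (fun s => pmass μ (fun ω => (X ω, Z ω)) (s, z)) = p
  have hp' : ∀ s, pmass μ (fun ω => (X ω, Z ω)) (s, z) = p s := fun s => by rw [← hp]
  simp only [hp'] at *
  by_cases hc : c = 0
  · subst hc
    have h0 := (Finset.sum_eq_zero_iff_of_nonneg (fun s _ => hnn s)).1 hm
    rw [Finset.sum_eq_zero (f := fun s => Real.negMulLog (p s))]
    · simp
    · intro s hs
      simp [h0 s hs]
  · rw [Finset.mul_sum]
    have : ∀ s ∈ Finset.univ.image X, c * Real.negMulLog (p s / c)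
        = Real.negMulLog (p s) + p s * Real.log c := by
      intro s _
      unfold Real.negMulLog
      by_cases h : p s = 0
      · simp [h]
      · rw [Real.log_div h hc]
        field_simp
        ring
    rw [Finset.sum_congr rfl this, Finset.sum_add_distrib, ← Finset.sum_mul, hm]
    unfold Real.negMulLog
    ring

lemma pmass_prod {Ω Ω' S T : Type*} [Fintype Ω] [Fintype Ω'] (μ : Ω → ℝ) (ν : Ω' → ℝ)
    (X : Ω → S) (Y : Ω' → T) (s : S) (t : T) :
    pmass (fun p : Ω × Ω' => μ p.1 * ν p.2) (fun p => (X p.1, Y p.2)) (s, t)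
      = pmass μ X s * pmass ν Y t := by
  unfold pmass
  rw [Finset.sum_mul_sum, Fintype.sum_prod_type]
  refine Finset.sum_congr rfl fun a _ => Finset.sum_congr rfl fun b _ => ?_
  by_cases h : X a = s <;> by_cases h' : Y b = t <;> simp [h, h']

lemma ident_prod {Ω S T : Type*} [Fintype Ω] (μ : Ω → ℝ)
    (X : Ω → S) (Y : Ω → T) (h : IndepPair μ X Y) :
    IdentDist (fun p : Ω × Ω => μ p.1 * μ p.2) (fun p => (X p.1, Y p.2))
      μ (fun ω => (X ω, Y ω)) := by
  rintro ⟨s, t⟩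
  rw [pmass_prod, h]

lemma ent_prod {Ω S T U : Type*} [Fintype Ω] (μ : Ω → ℝ)
    (X : Ω → S) (Y : Ω → T) (h : IndepPair μ X Y) (f : S × T → U) :
    ent (fun p : Ω × Ω => μ p.1 * μ p.2) (fun p => f (X p.1, Y p.2))
      = ent μ (fun ω => f (X ω, Y ω)) :=
  ent_ident _ _ _ _ (ident_comp _ _ _ _ (ident_prod μ X Y h) f)

lemma rdist_indep {Ω G : Type*} [Fintype Ω] [AddCommGroup G] (μ : Ω → ℝ)
    (X Y : Ω → G) (h : IndepPair μ X Y) :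
    rdist μ X μ Y = ent μ (fun ω => X ω - Y ω) - ent μ X / 2 - ent μ Y / 2 := by
  unfold rdist
  rw [ent_prod μ X Y h (fun q => q.1 - q.2)]

lemma ent_pair {Ω S T : Type*} [Fintype Ω] (μ : Ω → ℝ) (hμ : IsProb μ)
    (X : Ω → S) (Y : Ω → T) (h : IndepPair μ X Y) :
    ent μ (fun ω => (X ω, Y ω)) = ent μ X + ent μ Y := by
  have hX := sum_pmass μ X (Finset.univ.image X) (by intro ω; simp)
  have hY := sum_pmass μ Y (Finset.univ.image Y) (by intro ω; simp)
  rw [hμ.2] at hX hY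
  rw [ent_eq_sum μ (fun ω => (X ω, Y ω)) (Finset.univ.image X ×ˢ Finset.univ.image Y)
      (by intro ω; simp), Finset.sum_product]
  simp only [h _ _, Real.negMulLog_mul, Finset.sum_add_distrib, ← Finset.sum_mul,
    ← Finset.mul_sum, hX, hY, one_mul]
  rfl

lemma indep_comp {Ω S T U V : Type*} [Fintype Ω] (μ : Ω → ℝ)
    (X : Ω → S) (Y : Ω → T) (h : IndepPair μ X Y) (f : S → U) (g : T → V) :
    IndepPair μ (fun ω => f (X ω)) (fun ω => g (Y ω)) := by
  intro u v
  have h1 := ident_comp _ _ _ _ (ident_prod μ X Y h) (fun q => (f q.1, g q.2)) (u, v)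
  rw [← h1]
  exact pmass_prod μ μ (fun ω => f (X ω)) (fun ω => g (Y ω)) u v

lemma indep_four_pair {Ω S T U V : Type*} [Fintype Ω] (μ : Ω → ℝ) (hμ : IsProb μ)
    (X : Ω → S) (Y : Ω → T) (Z : Ω → U) (W : Ω → V) (h : IndepFour μ X Y Z W) :
    IndepPair μ (fun ω => (X ω, Y ω)) (fun ω => (Z ω, W ω)) := by
  have hX := sum_pmass μ X (Finset.univ.image X) (by intro ω; simp)
  have hY := sum_pmass μ Y (Finset.univ.image Y) (by intro ω; simp)
  have hZ := sum_pmass μ Z (Finset.univ.image Z) (by intro ω; simp)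
  have hW := sum_pmass μ W (Finset.univ.image W) (by intro ω; simp)
  rw [hμ.2] at hX hY hZ hW
  have e1 : ∀ a b c d, pmass μ (fun ω => ((X ω, Y ω), (Z ω, W ω))) ((a, b), (c, d))
      = pmass μ X a * pmass μ Y b * pmass μ Z c * pmass μ W d := by
    intro a b c d
    rw [← h a b c d]
    exact pmass_inj μ (fun ω => (X ω, Y ω, Z ω, W ω)) (fun q => ((q.1, q.2.1), q.2.2))
      (by rintro ⟨_, _, _⟩ ⟨_, _, _⟩ h; simp_all) (a, b, c, d)
  have e2 : ∀ a b c d, pmass μ (fun ω => ((Z ω, W ω), (X ω, Y ω))) ((c, d), (a, b))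
      = pmass μ X a * pmass μ Y b * pmass μ Z c * pmass μ W d := by
    intro a b c d
    rw [← h a b c d]
    exact pmass_inj μ (fun ω => (X ω, Y ω, Z ω, W ω)) (fun q => (q.2.2, (q.1, q.2.1)))
      (by rintro ⟨_, _, _⟩ ⟨_, _, _⟩ h; simp_all) (a, b, c, d)
  have m1 : ∀ a b, pmass μ (fun ω => (X ω, Y ω)) (a, b) = pmass μ X a * pmass μ Y b := by
    intro a b
    rw [← pmass_marg μ (fun ω => (Z ω, W ω)) (fun ω => (X ω, Y ω)) (a, b)
      (Finset.univ.image Z ×ˢ Finset.univ.image W) (by intro ω; simp), Finset.sum_product]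
    simp only [e2, ← Finset.mul_sum, hZ, hW, mul_one]
  have m2 : ∀ c d, pmass μ (fun ω => (Z ω, W ω)) (c, d) = pmass μ Z c * pmass μ W d := by
    intro c d
    rw [← pmass_marg μ (fun ω => (X ω, Y ω)) (fun ω => (Z ω, W ω)) (c, d)
      (Finset.univ.image X ×ˢ Finset.univ.image Y) (by intro ω; simp), Finset.sum_product]
    simp only [e1, ← Finset.sum_mul, ← Finset.mul_sum, hX, hY, mul_one, one_mul]
  rintro ⟨a, b⟩ ⟨c, d⟩
  rw [e1, m1, m2]
  ring

lemma indep_four_swap {Ω S T U V : Type*} [Fintype Ω] (μ : Ω → ℝ)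
    (X : Ω → S) (Y : Ω → T) (Z : Ω → U) (W : Ω → V) (h : IndepFour μ X Y Z W) :
    IndepFour μ X Z Y W := by
  intro a c b d
  have : pmass μ (fun ω => (X ω, Z ω, Y ω, W ω)) (a, c, b, d)
      = pmass μ (fun ω => (X ω, Y ω, Z ω, W ω)) (a, b, c, d) :=
    pmass_inj μ (fun ω => (X ω, Y ω, Z ω, W ω)) (fun q => (q.1, q.2.2.1, q.2.1, q.2.2.2))
      (by rintro ⟨_, _, _⟩ ⟨_, _, _⟩ h; simp_all [Prod.ext_iff]) (a, b, c, d)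
  rw [this, h]
  ring

lemma condMeas_prod {Ω Ω' S T : Type*} [Fintype Ω] [Fintype Ω'] (μ : Ω → ℝ) (ν : Ω' → ℝ)
    (Z : Ω → S) (W : Ω' → T) (z : S) (w : T) :
    (fun p : Ω × Ω' => condMeas μ Z z p.1 * condMeas ν W w p.2)
      = condMeas (fun p : Ω × Ω' => μ p.1 * ν p.2) (fun p => (Z p.1, W p.2)) (z, w) := by
  funext p
  unfold condMeas
  rw [pmass_prod]
  by_cases h : Z p.1 = z <;> by_cases h' : W p.2 = w <;> simp [h, h', div_mul_div_comm]

lemma condRdist_eq {Ω G S T : Type*} [Fintype Ω] [AddCommGroup G] (μ : Ω → ℝ)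
    (hμ : IsProb μ) (X Y : Ω → G) (Z : Ω → S) (W : Ω → T) :
    condRdist μ X Z μ Y W
      = (ent (fun p : Ω × Ω => μ p.1 * μ p.2) (fun p => (X p.1 - Y p.2, (Z p.1, W p.2)))
          - ent (fun p : Ω × Ω => μ p.1 * μ p.2) (fun p => (Z p.1, W p.2)))
        - (ent μ (fun ω => (X ω, Z ω)) - ent μ Z) / 2
        - (ent μ (fun ω => (Y ω, W ω)) - ent μ W) / 2 := by
  have hZ := sum_pmass μ Z (Finset.univ.image Z) (by intro ω; simp)
  have hW := sum_pmass μ W (Finset.univ.image W) (by intro ω; simp)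
  rw [hμ.2] at hZ hW
  rw [← chain_rule μ hμ.1 X Z (Finset.univ.image Z) (by intro ω; simp),
    ← chain_rule μ hμ.1 Y W (Finset.univ.image W) (by intro ω; simp),
    ← chain_rule (fun p : Ω × Ω => μ p.1 * μ p.2) (fun p => mul_nonneg (hμ.1 _) (hμ.1 _))
      (fun p => X p.1 - Y p.2) (fun p => (Z p.1, W p.2))
      (Finset.univ.image Z ×ˢ Finset.univ.image W) (by intro ω; simp), Finset.sum_product]
  unfold condRdist rdist
  simp only [condMeas_prod, pmass_prod, mul_sub, Finset.sum_sub_distrib]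
  congr 1
  · congr 1
    rw [Finset.sum_div]
    refine Finset.sum_congr rfl fun z _ => ?_
    rw [← Finset.sum_mul, ← Finset.mul_sum, hW]
    ring
  · rw [Finset.sum_comm, Finset.sum_div]
    refine Finset.sum_congr rfl fun w _ => ?_
    rw [← Finset.sum_mul, ← Finset.sum_mul, hZ]
    ring

lemma condMutualInfo_eq {Ω S T U : Type*} [Fintype Ω] (μ : Ω → ℝ)
    (hμ : IsProb μ) (X : Ω → S) (Y : Ω → T) (Z : Ω → U) :
    condMutualInfo μ X Y Z
      = ent μ (fun ω => (X ω, Z ω)) + ent μ (fun ω => (Y ω, Z ω))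
        - ent μ (fun ω => ((X ω, Y ω), Z ω)) - ent μ Z := by
  have c1 := chain_rule μ hμ.1 X Z (Finset.univ.image Z) (by intro ω; simp)
  have c2 := chain_rule μ hμ.1 Y Z (Finset.univ.image Z) (by intro ω; simp)
  have c3 := chain_rule μ hμ.1 (fun ω => (X ω, Y ω)) Z (Finset.univ.image Z)
    (by intro ω; simp)
  unfold condMutualInfo mutualInfo
  simp only [mul_sub, mul_add, Finset.sum_sub_distrib, Finset.sum_add_distrib]
  rw [c1, c2, c3]
  ring

/-- **Special case of the fibring lemma (Corollary 4.2).** For independent `Y₁, Y₂, Y₃, Y₄`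
taking values in an abelian group `G`:
`d[Y₁ - Y₃; Y₂ - Y₄] + d[Y₁ | Y₁ - Y₃; Y₂ | Y₂ - Y₄]
  + I[Y₁ - Y₂ : Y₂ - Y₄ | Y₁ - Y₂ - Y₃ + Y₄] = d[Y₁; Y₂] + d[Y₃; Y₄]`. -/
theorem fibring_corollary {G Ω : Type*} [AddCommGroup G] [Fintype Ω]
    (μ : Ω → ℝ) (hμ : IsProb μ) (Y₁ Y₂ Y₃ Y₄ : Ω → G)
    (hindep : IndepFour μ Y₁ Y₂ Y₃ Y₄) :
    rdist μ (fun ω => Y₁ ω - Y₃ ω) μ (fun ω => Y₂ ω - Y₄ ω)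
      + condRdist μ Y₁ (fun ω => Y₁ ω - Y₃ ω) μ Y₂ (fun ω => Y₂ ω - Y₄ ω)
      + condMutualInfo μ (fun ω => Y₁ ω - Y₂ ω) (fun ω => Y₂ ω - Y₄ ω)
          (fun ω => Y₁ ω - Y₂ ω - Y₃ ω + Y₄ ω)
    = rdist μ Y₁ μ Y₂ + rdist μ Y₃ μ Y₄ := by
  have P := indep_four_pair μ hμ Y₁ Y₂ Y₃ Y₄ hindep
  have Q := indep_four_pair μ hμ Y₁ Y₃ Y₂ Y₄ (indep_four_swap μ Y₁ Y₂ Y₃ Y₄ hindep)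
  have i13 : IndepPair μ Y₁ Y₃ := indep_comp μ _ _ P Prod.fst Prod.fst
  have i24 : IndepPair μ Y₂ Y₄ := indep_comp μ _ _ P Prod.snd Prod.snd
  have i12 : IndepPair μ Y₁ Y₂ := indep_comp μ _ _ Q Prod.fst Prod.fst
  have i34 : IndepPair μ Y₃ Y₄ := indep_comp μ _ _ Q Prod.snd Prod.snd
  have iAB : IndepPair μ (fun ω => Y₁ ω - Y₃ ω) (fun ω => Y₂ ω - Y₄ ω) :=
    indep_comp μ _ _ Q (fun q => q.1 - q.2) (fun q => q.1 - q.2)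
  have iD : IndepPair μ (fun ω => Y₁ ω - Y₂ ω) (fun ω => Y₃ ω - Y₄ ω) :=
    indep_comp μ _ _ P (fun q => q.1 - q.2) (fun q => q.1 - q.2)
  rw [rdist_indep μ _ _ i12, rdist_indep μ _ _ i34, rdist_indep μ _ _ iAB,
    condRdist_eq μ hμ, condMutualInfo_eq μ hμ]
  have h1 : ent (fun p : Ω × Ω => μ p.1 * μ p.2)
      (fun p => (Y₁ p.1 - Y₂ p.2, (Y₁ p.1 - Y₃ p.1, Y₂ p.2 - Y₄ p.2)))
      = ent μ (fun ω => (Y₁ ω - Y₂ ω, (Y₁ ω - Y₃ ω, Y₂ ω - Y₄ ω))) :=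
    ent_prod μ _ _ Q (fun q => (q.1.1 - q.2.1, (q.1.1 - q.1.2, q.2.1 - q.2.2)))
  have h2 : ent (fun p : Ω × Ω => μ p.1 * μ p.2)
      (fun p => (Y₁ p.1 - Y₃ p.1, Y₂ p.2 - Y₄ p.2))
      = ent μ (fun ω => (Y₁ ω - Y₃ ω, Y₂ ω - Y₄ ω)) :=
    ent_prod μ _ _ iAB (fun q => q)
  have h3 : ent μ (fun ω => (Y₁ ω, Y₁ ω - Y₃ ω)) = ent μ Y₁ + ent μ Y₃ := by
    rw [← ent_pair μ hμ _ _ i13]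
    exact ent_inj μ (fun ω => (Y₁ ω, Y₃ ω)) (fun q => (q.1, q.1 - q.2))
      (by rintro ⟨a, b⟩ ⟨c, d⟩ h; simp only [Prod.mk.injEq] at h ⊢
          obtain ⟨rfl, h⟩ := h; exact ⟨rfl, sub_right_injective h⟩)
  have h4 : ent μ (fun ω => (Y₂ ω, Y₂ ω - Y₄ ω)) = ent μ Y₂ + ent μ Y₄ := by
    rw [← ent_pair μ hμ _ _ i24]
    exact ent_inj μ (fun ω => (Y₂ ω, Y₄ ω)) (fun q => (q.1, q.1 - q.2))
      (by rintro ⟨a, b⟩ ⟨c, d⟩ h; simp only [Prod.mk.injEq] at h ⊢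
          obtain ⟨rfl, h⟩ := h; exact ⟨rfl, sub_right_injective h⟩)
  have h5 : ent μ (fun ω => (Y₁ ω - Y₂ ω, Y₁ ω - Y₂ ω - Y₃ ω + Y₄ ω))
      = ent μ (fun ω => Y₁ ω - Y₂ ω) + ent μ (fun ω => Y₃ ω - Y₄ ω) := by
    rw [← ent_pair μ hμ _ _ iD,
      ← ent_inj μ (fun ω => (Y₁ ω - Y₂ ω, Y₃ ω - Y₄ ω)) (fun q => (q.1, q.1 - q.2))
      (by rintro ⟨a, b⟩ ⟨c, d⟩ h; simp only [Prod.mk.injEq] at h ⊢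
          obtain ⟨rfl, h⟩ := h; exact ⟨rfl, sub_right_injective h⟩)]
    congr 1; funext ω; ext
    · rfl
    · dsimp only; abel
  have h6 : ent μ (fun ω => (Y₂ ω - Y₄ ω, Y₁ ω - Y₂ ω - Y₃ ω + Y₄ ω))
      = ent μ (fun ω => (Y₁ ω - Y₃ ω, Y₂ ω - Y₄ ω)) := by
    rw [← ent_inj μ (fun ω => (Y₁ ω - Y₃ ω, Y₂ ω - Y₄ ω)) (fun q => (q.2, q.1 - q.2))
      (by rintro ⟨a, b⟩ ⟨c, d⟩ h; simp only [Prod.mk.injEq] at h ⊢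
          obtain ⟨rfl, h⟩ := h; exact ⟨sub_left_injective h, rfl⟩)]
    congr 1; funext ω; ext
    · rfl
    · dsimp only; abel
  have h7 : ent μ (fun ω => ((Y₁ ω - Y₂ ω, Y₂ ω - Y₄ ω), Y₁ ω - Y₂ ω - Y₃ ω + Y₄ ω))
      = ent μ (fun ω => (Y₁ ω - Y₂ ω, (Y₁ ω - Y₃ ω, Y₂ ω - Y₄ ω))) := by
    rw [← ent_inj μ (fun ω => (Y₁ ω - Y₂ ω, (Y₁ ω - Y₃ ω, Y₂ ω - Y₄ ω)))
      (fun q => ((q.1, q.2.2), q.2.1 - q.2.2))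
      (by rintro ⟨a, b, e⟩ ⟨c, d, f⟩ h; simp only [Prod.mk.injEq] at h ⊢
          obtain ⟨⟨rfl, rfl⟩, h⟩ := h; exact ⟨rfl, sub_left_injective h, rfl⟩)]
    congr 1; funext ω; ext
    · rfl
    · rfl
    · dsimp only; abel
  have h8 : (fun ω => Y₁ ω - Y₃ ω - (Y₂ ω - Y₄ ω))
      = (fun ω => Y₁ ω - Y₂ ω - Y₃ ω + Y₄ ω) := by
    funext ω; abel
  rw [h1, h2, h3, h4, h5, h6, h7, h8]
  ring

end
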